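/- Let p be a prime. Then the number G_{g PR, h ANY}(p) of integers h with 1 ≤ h ≤ p-1 for which there exists some g with 1 ≤ g ≤ p-1, g a primitive root modulo p, and g^h ≡ h (mod p), satisfies |G_{g PR, h ANY}(p) − (1/(p-1)) · Σ_{e | p-1} φ((p-1)/e)²| ≤ d(p-1)³ · √p · (1 + ln p), where the sum runs over the positive divisors e of p-1. -/

import Mathlib

lemma aux_sum_zmod (p : ℕ) [NeZero p] (f : ZMod p → ℝ) :
    ∑ x : ZMod p, f x = ∑ a ∈ Finset.range p, f (a : ZMod p) := by
  refine Finset.sum_nbij' (fun x => x.val) (fun a => (a : ZMod p)) ?_ ?_ ?_ ?_ ?_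
  · intro x _
    exact Finset.mem_range.2 (ZMod.val_lt x)
  · intro x _
    exact Finset.mem_univ _
  · intro x _
    simp
  · intro a ha
    exact ZMod.val_cast_of_lt (Finset.mem_range.1 ha)
  · intro x _
    simp

lemma aux_sin_lower (p a : ℕ) (ha : 0 < a) (hap : a < p) :
    1 / Real.sin (Real.pi * a / p) ≤ (p / 2 : ℝ) * (1 / a + 1 / ((p : ℝ) - a)) := by
  have hp : (0 : ℝ) < p := by exact_mod_cast (by omega : 0 < p)
  have ha' : (0 : ℝ) < a := by exact_mod_cast ha
  have hb : (0 : ℝ) < (p : ℝ) - a := by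
    have : (a : ℝ) < p := by exact_mod_cast hap
    linarith
  have hpi := Real.pi_pos
  rcases le_total ((a : ℝ)) (p / 2) with h | h
  · have h1 : 2 / Real.pi * (Real.pi * a / p) ≤ Real.sin (Real.pi * a / p) := by
      apply Real.mul_le_sin (by positivity)
      rw [div_le_div_iff₀ hp (by norm_num)]
      nlinarith
    have h2 : 2 / Real.pi * (Real.pi * a / p) = 2 * a / p := by field_simp
    rw [h2] at h1
    have h3 : 1 / Real.sin (Real.pi * a / p) ≤ 1 / (2 * a / p) :=
      one_div_le_one_div_of_le (by positivity) h1
    refine h3.trans ?_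
    have : 1 / (2 * a / p) = (p / 2 : ℝ) * (1 / a) := by field_simp
    rw [this]
    have : 0 < 1 / ((p : ℝ) - a) := by positivity
    gcongr
    linarith
  · have h0 : Real.sin (Real.pi * a / p) = Real.sin (Real.pi * (p - a) / p) := by
      rw [← Real.sin_pi_sub]
      congr 1
      field_simp
    rw [h0]
    have h1 : 2 / Real.pi * (Real.pi * (p - a) / p) ≤ Real.sin (Real.pi * (p - a) / p) := by
      apply Real.mul_le_sin (by positivity)
      rw [div_le_div_iff₀ hp (by norm_num)]
      nlinarith
    have h2 : 2 / Real.pi * (Real.pi * (p - a) / p) = 2 * (p - a) / p := by field_simp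
    rw [h2] at h1
    have h3 : 1 / Real.sin (Real.pi * (p - a) / p) ≤ 1 / (2 * (p - a) / p) :=
      one_div_le_one_div_of_le (by positivity) h1
    refine h3.trans ?_
    have : 1 / (2 * ((p : ℝ) - a) / p) = (p / 2 : ℝ) * (1 / (p - a)) := by field_simp
    rw [this]
    have : 0 < 1 / (a : ℝ) := by positivity
    gcongr
    linarith

lemma aux_geom (p : ℕ) [NeZero p] (a : ℕ) (ha : 0 < a) (hap : a < p) (N : ℕ) :
    ‖∑ k ∈ Finset.range N, ZMod.stdAddChar ((a : ZMod p) * (k : ZMod p))‖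
      ≤ (p / 2 : ℝ) * (1 / a + 1 / ((p : ℝ) - a)) := by
  refine le_trans ?_ (aux_sin_lower p a ha hap)
  have hp : (0 : ℝ) < p := by exact_mod_cast (by omega : 0 < p)
  have ha' : (0 : ℝ) < a := by exact_mod_cast ha
  have hb : (a : ℝ) < p := by exact_mod_cast hap
  have hpi := Real.pi_pos
  set z : ℂ := ZMod.stdAddChar ((a : ZMod p)) with hz
  have h1 : ∀ k : ℕ, ZMod.stdAddChar ((a : ZMod p) * (k : ZMod p)) = z ^ k := by
    intro k
    rw [hz, ← AddChar.map_nsmul_eq_pow, nsmul_eq_mul, mul_comm]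
  have hz2 : z = Complex.exp (Complex.I * ((2 * Real.pi * a / p : ℝ) : ℂ)) := by
    have := ZMod.stdAddChar_coe (N := p) (a : ℤ)
    push_cast at this
    rw [hz, this]
    congr 1
    push_cast
    ring
  have hs : 0 < Real.sin (Real.pi * a / p) := by
    apply Real.sin_pos_of_pos_of_lt_pi (by positivity)
    rw [div_lt_iff₀ hp]
    nlinarith
  have hn : ‖z - 1‖ = 2 * Real.sin (Real.pi * a / p) := by
    rw [hz2, Complex.norm_exp_I_mul_ofReal_sub_one]
    have : 2 * Real.pi * a / p / 2 = Real.pi * a / p := by ring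
    rw [this, Real.norm_of_nonneg (by positivity)]
  have hz1 : z ≠ 1 := by
    intro h
    rw [h] at hn
    simp at hn
    linarith
  have hnz : ‖z‖ = 1 := by
    rw [hz2, mul_comm, Complex.norm_exp_ofReal_mul_I]
  simp_rw [h1]
  rw [geom_sum_eq hz1, norm_div, hn, div_le_div_iff₀ (by positivity) hs]
  have : ‖z ^ N - 1‖ ≤ 2 := by
    refine (norm_sub_le _ _).trans ?_
    rw [norm_pow, hnz]
    norm_num
  nlinarith

lemma aux_gauss_norm (p : ℕ) [Fact p.Prime] (χ : MulChar (ZMod p) ℂ) (hχ : χ ≠ 1) :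
    ‖gaussSum χ (ZMod.stdAddChar (N := p))‖ = Real.sqrt p := by
  have h := gaussSum_mul_gaussSum_eq_card hχ (ZMod.isPrimitive_stdAddChar p)
  rw [← star_gaussSum_eq] at h
  have h2 := congrArg norm h
  rw [norm_mul, norm_star, ZMod.card] at h2
  rw [eq_comm, Real.sqrt_eq_iff_mul_self_eq (by positivity) (by positivity)]
  simpa using h2.symm

lemma aux_recip_sum (p : ℕ) (hp : 0 < p) :
    ∑ a ∈ Finset.range (p - 1), (p / 2 : ℝ) * (1 / ((a + 1 : ℕ) : ℝ) + 1 / ((p : ℝ) - (a + 1 : ℕ)))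
      ≤ p * (1 + Real.log p) := by
  have h1 : ∑ a ∈ Finset.range (p - 1), 1 / ((a + 1 : ℕ) : ℝ) ≤ 1 + Real.log p := by
    have h := harmonic_le_one_add_log (p - 1)
    have e : ((harmonic (p - 1) : ℚ) : ℝ) = ∑ a ∈ Finset.range (p - 1), 1 / ((a + 1 : ℕ) : ℝ) := by
      simp [harmonic]
    rw [e] at h
    refine h.trans ?_
    by_cases h0 : p - 1 = 0
    · rw [h0]
      simp
      exact Real.log_natCast_nonneg p
    · have : Real.log ((p - 1 : ℕ) : ℝ) ≤ Real.log p := by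
        apply Real.log_le_log
        · exact_mod_cast Nat.pos_of_ne_zero h0
        · exact_mod_cast Nat.sub_le p 1
      linarith
  have h2 : ∑ a ∈ Finset.range (p - 1), 1 / ((p : ℝ) - (a + 1 : ℕ)) =
      ∑ a ∈ Finset.range (p - 1), 1 / ((a + 1 : ℕ) : ℝ) := by
    rw [← Finset.sum_range_reflect]
    apply Finset.sum_congr rfl
    intro a ha
    have ha' := Finset.mem_range.1 ha
    have : p - 1 - 1 - a + 1 = p - (a + 1) := by omega
    rw [this, Nat.cast_sub (by omega)]
    congr 1
    ring
  rw [← Finset.mul_sum, Finset.sum_add_distrib, h2]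
  have : (0 : ℝ) ≤ p := by positivity
  nlinarith

/-- Pólya–Vinogradov. -/
lemma aux_PV (p : ℕ) [Fact p.Prime] (χ : MulChar (ZMod p) ℂ) (hχ : χ ≠ 1) (N : ℕ) :
    ‖∑ k ∈ Finset.range N, χ (k : ZMod p)‖ ≤ Real.sqrt p * (1 + Real.log p) := by
  have hpp : p.Prime := Fact.out
  have hp0 : (0 : ℝ) < p := by exact_mod_cast hpp.pos
  have hχ' : χ⁻¹ ≠ 1 := by simpa using hχ
  have key : ∀ k : ZMod p, χ k * gaussSum χ⁻¹ (ZMod.stdAddChar (N := p)) =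
      ∑ x : ZMod p, χ⁻¹ x * ZMod.stdAddChar (x * k) := by
    intro k
    by_cases hk : k = 0
    · subst hk
      simp [MulChar.sum_eq_zero_of_ne_one hχ', MulChar.map_zero]
    · have h := gaussSum_mulShift_eq χ⁻¹ (ZMod.stdAddChar (N := p)) (Units.mk0 k hk)
      simp only [Units.val_mk0, inv_inv] at h
      rw [← h]
      simp only [gaussSum, AddChar.mulShift_apply]
      simp_rw [mul_comm k]
  have key2 : (∑ k ∈ Finset.range N, χ (k : ZMod p)) * gaussSum χ⁻¹ (ZMod.stdAddChar (N := p)) =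
      ∑ x : ZMod p, χ⁻¹ x * ∑ k ∈ Finset.range N, ZMod.stdAddChar (x * (k : ZMod p)) := by
    rw [Finset.sum_mul]
    simp_rw [key, Finset.mul_sum]
    rw [Finset.sum_comm]
  have hb : ‖∑ x : ZMod p, χ⁻¹ x * ∑ k ∈ Finset.range N, ZMod.stdAddChar (x * (k : ZMod p))‖
      ≤ p * (1 + Real.log p) := by
    refine (norm_sum_le _ _).trans ?_
    rw [aux_sum_zmod]
    have : p = (p - 1) + 1 := by have := hpp.pos; omega
    rw [show Finset.range p = Finset.range ((p - 1) + 1) by rw [← this], Finset.sum_range_succ']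
    refine le_trans ?_ (aux_recip_sum p hpp.pos)
    simp only [Nat.cast_zero, MulChar.map_zero, zero_mul, norm_zero, add_zero]
    apply Finset.sum_le_sum
    intro a ha
    have ha' := Finset.mem_range.1 ha
    rw [norm_mul]
    have h1 : ‖χ⁻¹ ((a + 1 : ℕ) : ZMod p)‖ ≤ 1 := DirichletCharacter.norm_le_one _ _
    have h2 := aux_geom p (a + 1) (by omega) (by omega) N
    exact (mul_le_mul h1 h2 (norm_nonneg _) zero_le_one).trans_eq (one_mul _)
  rw [← key2, norm_mul, aux_gauss_norm p _ hχ'] at hb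
  have hs : 0 < Real.sqrt p := Real.sqrt_pos.2 hp0
  have hss : Real.sqrt p * Real.sqrt p = p := Real.mul_self_sqrt hp0.le
  refine le_of_mul_le_mul_right (hb.trans_eq ?_) hs
  linear_combination (-(1 + Real.log p)) * hss

lemma aux_moebius_sum (m : ℕ) :
    ∑ b ∈ m.divisors, (ArithmeticFunction.moebius b : ℝ) = if m = 1 then 1 else 0 := by
  have h := congrArg (fun f => f m) (ArithmeticFunction.coe_zeta_mul_coe_moebius (R := ℝ))
  simp only [ArithmeticFunction.coe_zeta_mul_apply, ArithmeticFunction.one_apply,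
    ArithmeticFunction.intCoe_apply] at h
  exact h

lemma aux_moebius (n e x : ℕ) (hn : 0 < n) (he : e ∣ n) :
    (if x.gcd n = e then (1 : ℝ) else 0) =
      ∑ b ∈ (n / e).divisors, (ArithmeticFunction.moebius b : ℝ) * (if e * b ∣ x then 1 else 0) := by
  obtain ⟨m, rfl⟩ := he
  have he0 : 0 < e := Nat.pos_of_mul_pos_right hn
  have hm0 : 0 < m := Nat.pos_of_mul_pos_left hn
  rw [Nat.mul_div_cancel_left _ he0]
  by_cases hx : e ∣ x
  · obtain ⟨y, rfl⟩ := hx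
    rw [Nat.gcd_mul_left]
    have h1 : (e * y.gcd m = e) ↔ y.gcd m = 1 := by
      constructor
      · intro h
        exact Nat.eq_of_mul_eq_mul_left he0 (by rw [h, mul_one])
      · intro h
        rw [h, mul_one]
    simp only [h1, Nat.mul_dvd_mul_iff_left he0]
    rw [← aux_moebius_sum]
    simp only [mul_ite, mul_one, mul_zero]
    rw [← Finset.sum_filter]
    apply Finset.sum_congr _ (fun _ _ => rfl)
    ext b
    simp only [Nat.mem_divisors, Finset.mem_filter, Nat.dvd_gcd_iff]
    have : y.gcd m ≠ 0 := (Nat.gcd_pos_of_pos_right _ hm0).ne'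
    constructor
    · rintro ⟨⟨h1, h2⟩, h3⟩
      exact ⟨⟨h2, hm0.ne'⟩, h1⟩
    · rintro ⟨⟨h1, h2⟩, h3⟩
      exact ⟨⟨h3, h1⟩, this⟩
  · rw [if_neg]
    · symm
      apply Finset.sum_eq_zero
      intro b _
      rw [if_neg, mul_zero]
      intro h
      exact hx (dvd_trans (dvd_mul_right _ _) h)
    · intro h
      exact hx (h ▸ Nat.gcd_dvd_left _ _)

lemma aux_totient (m : ℕ) (hm : 0 < m) :
    (m.totient : ℝ) = ∑ b ∈ m.divisors, (ArithmeticFunction.moebius b : ℝ) * (m / b) := by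
  have h := (ArithmeticFunction.sum_eq_iff_sum_mul_moebius_eq
    (f := fun n => (n.totient : ℝ)) (g := fun n => (n : ℝ))).1 (by
      intro n _
      exact_mod_cast Nat.sum_totient n) m hm
  rw [← h, Nat.sum_divisorsAntidiagonal (f := fun a b => (ArithmeticFunction.moebius a : ℝ) * (b : ℝ))]
  apply Finset.sum_congr rfl
  intro b hb
  have hb' := Nat.dvd_of_mem_divisors hb
  have hb0 : (b : ℝ) ≠ 0 := by exact_mod_cast (Nat.pos_of_mem_divisors hb).ne'
  rw [Nat.cast_div hb' hb0]

lemma aux_mult_sum (a m : ℕ) (ha : 0 < a) (f : ℕ → ℂ) :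
    ∑ h ∈ Finset.Icc 1 (a * m), (if a ∣ h then f h else 0) =
      ∑ k ∈ Finset.range m, f (a * (k + 1)) := by
  rw [← Finset.sum_filter]
  symm
  refine Finset.sum_nbij' (fun k => a * (k + 1)) (fun h => h / a - 1) ?_ ?_ ?_ ?_ ?_
  · intro k hk
    have hk' := Finset.mem_range.1 hk
    simp only [Finset.mem_filter, Finset.mem_Icc]
    exact ⟨⟨Nat.mul_pos ha (by omega), Nat.mul_le_mul_left _ (by omega)⟩, dvd_mul_right _ _⟩
  · intro h hh
    simp only [Finset.mem_filter, Finset.mem_Icc] at hh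
    obtain ⟨⟨h1, h2⟩, ⟨k, rfl⟩⟩ := hh
    have hk : k ≤ m := Nat.le_of_mul_le_mul_left h2 ha
    have hk0 : 0 < k := Nat.pos_of_mul_pos_left h1
    rw [Nat.mul_div_cancel_left _ ha, Finset.mem_range]
    omega
  · intro k hk
    simp [Nat.mul_div_cancel_left _ ha]
  · intro h hh
    simp only [Finset.mem_filter, Finset.mem_Icc] at hh
    obtain ⟨⟨h1, h2⟩, ⟨k, rfl⟩⟩ := hh
    have hk0 : 0 < k := Nat.pos_of_mul_pos_left h1
    rw [Nat.mul_div_cancel_left _ ha]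
    congr 1
    omega
  · intro k hk
    rfl

lemma aux_root_sum (n c x : ℕ) (hn : 0 < n) (hc : c ∣ n) (ζ : ℂ) (hζ : IsPrimitiveRoot ζ n) :
    ∑ j ∈ Finset.range c, (ζ ^ x) ^ (n / c * j) = if c ∣ x then (c : ℂ) else 0 := by
  obtain ⟨m, rfl⟩ := hc
  have hc0 : 0 < c := Nat.pos_of_mul_pos_right hn
  have hm0 : 0 < m := Nat.pos_of_mul_pos_left hn
  rw [Nat.mul_div_cancel_left _ hc0]
  have h1 : (ζ ^ x) ^ m = 1 ↔ c ∣ x := by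
    rw [← pow_mul, hζ.pow_eq_one_iff_dvd, Nat.mul_dvd_mul_iff_right hm0]
  simp_rw [pow_mul _ m]
  split_ifs with h
  · simp [h1.2 h]
  · have h2 : (ζ ^ x) ^ m ≠ 1 := fun h' => h (h1.1 h')
    rw [geom_sum_eq h2]
    have : ((ζ ^ x) ^ m) ^ c = 1 := by
      rw [← pow_mul, ← pow_mul, mul_comm, mul_comm m c, pow_mul, hζ.pow_eq_one, one_pow]
    rw [this]
    simp

lemma aux_N (p : ℕ) [Fact p.Prime] (g0 : ZMod p) (hg0 : IsPrimitiveRoot g0 (p - 1))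
    (ind : ℕ → ℕ) (hind : ∀ h ∈ Finset.Icc 1 (p - 1), g0 ^ ind h = (h : ZMod p))
    (χ : MulChar (ZMod p) ℂ) (hχ : IsPrimitiveRoot (χ g0) (p - 1)) (a c : ℕ)
    (ha : a ∣ p - 1) (hc : c ∣ p - 1) :
    |∑ h ∈ Finset.Icc 1 (p - 1), (if a ∣ h then (1 : ℝ) else 0) * (if c ∣ ind h then 1 else 0)
      - ((p - 1 : ℕ) : ℝ) / (a * c)| ≤ Real.sqrt p * (1 + Real.log p) := by
  have hpp : p.Prime := Fact.out
  have hn : 0 < p - 1 := by have := hpp.two_le; omega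
  have hc0 : 0 < c := Nat.pos_of_dvd_of_pos hc hn
  have ha0 : 0 < a := Nat.pos_of_dvd_of_pos ha hn
  have hg00 : g0 ≠ 0 := by
    intro h
    have := hg0.pow_eq_one
    rw [h, zero_pow hn.ne'] at this
    exact zero_ne_one this
  obtain ⟨m, hm⟩ := ha
  set B := Real.sqrt p * (1 + Real.log p) with hB
  have hB0 : 0 ≤ B := by
    have := Real.log_natCast_nonneg p
    positivity
  set S : ℝ := ∑ h ∈ Finset.Icc 1 (p - 1), (if a ∣ h then (1 : ℝ) else 0) *
    (if c ∣ ind h then 1 else 0) with hS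
  -- the characters
  have hne : ∀ h ∈ Finset.Icc 1 (p - 1), (h : ZMod p) ≠ 0 := by
    intro h hh
    rw [← hind h hh]
    exact pow_ne_zero _ hg00
  have hchar : ∀ h ∈ Finset.Icc 1 (p - 1),
      ∑ j ∈ Finset.range c, (χ ^ ((p - 1) / c * j)) (h : ZMod p) =
        if c ∣ ind h then (c : ℂ) else 0 := by
    intro h hh
    rw [← aux_root_sum (p - 1) c (ind h) hn hc (χ g0) hχ]
    apply Finset.sum_congr rfl
    intro j _
    have hu : IsUnit (h : ZMod p) := isUnit_iff_ne_zero.2 (hne h hh)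
    have : χ (h : ZMod p) = χ g0 ^ ind h := by rw [← hind h hh, map_pow]
    rw [← this, ← hu.unit_spec, MulChar.pow_apply_coe]
  have hnt : ∀ j ∈ Finset.range c, j ≠ 0 → χ ^ ((p - 1) / c * j) ≠ 1 := by
    intro j hj hj0 h
    have hj' := Finset.mem_range.1 hj
    have hu : IsUnit g0 := isUnit_iff_ne_zero.2 hg00
    have h2 := congrArg (fun f : MulChar (ZMod p) ℂ => f g0) h
    rw [← hu.unit_spec, MulChar.pow_apply_coe, MulChar.one_apply_coe, hu.unit_spec,
      hχ.pow_eq_one_iff_dvd] at h2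
    obtain ⟨l, hl⟩ := hc
    rw [hl, Nat.mul_div_cancel_left _ hc0, mul_comm l j] at h2
    have hl0 : 0 < l := Nat.pos_of_mul_pos_left (hl ▸ hn)
    have := Nat.dvd_of_mul_dvd_mul_right hl0 h2
    exact absurd (Nat.le_of_dvd (Nat.pos_of_ne_zero hj0) this) (by omega)
  have hcS : (c : ℂ) * (S : ℂ) = ∑ j ∈ Finset.range c, ∑ k ∈ Finset.range m,
      (χ ^ ((p - 1) / c * j)) ((a * (k + 1) : ℕ) : ZMod p) := by
    rw [Finset.sum_comm]
    rw [← aux_mult_sum a m ha0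
      (fun h => ∑ j ∈ Finset.range c, (χ ^ ((p - 1) / c * j)) (h : ZMod p)), ← hm, hS]
    push_cast
    rw [Finset.mul_sum]
    apply Finset.sum_congr rfl
    intro h hh
    rw [hchar h hh]
    split_ifs <;> simp
  have hbd : ∀ j ∈ Finset.range c, j ≠ 0 → ‖∑ k ∈ Finset.range m,
      (χ ^ ((p - 1) / c * j)) ((a * (k + 1) : ℕ) : ZMod p)‖ ≤ B := by
    intro j hj hj0
    have h1 := aux_PV p _ (hnt j hj hj0) (m + 1)
    rw [Finset.sum_range_succ', Nat.cast_zero, MulChar.map_zero, add_zero] at h1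
    simp_rw [Nat.cast_mul a, map_mul]
    rw [← Finset.mul_sum, norm_mul]
    have h2 : ‖(χ ^ ((p - 1) / c * j)) (a : ZMod p)‖ ≤ 1 := DirichletCharacter.norm_le_one _ _
    exact (mul_le_mul h2 h1 (norm_nonneg _) zero_le_one).trans_eq (one_mul _)
  obtain ⟨d, rfl⟩ : ∃ d, c = d + 1 := ⟨c - 1, by omega⟩
  rw [Finset.sum_range_succ'] at hcS
  have h0 : ∑ k ∈ Finset.range m, (χ ^ ((p - 1) / (d + 1) * 0)) ((a * (k + 1) : ℕ) : ZMod p)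
      = (m : ℂ) := by
    rw [Finset.sum_congr rfl (g := fun _ => (1 : ℂ))]
    · simp
    · intro k hk
      have hk' := Finset.mem_range.1 hk
      rw [mul_zero, pow_zero]
      apply MulChar.one_apply
      apply isUnit_iff_ne_zero.2
      apply hne
      rw [Finset.mem_Icc, hm]
      exact ⟨Nat.mul_pos ha0 (by omega), Nat.mul_le_mul_left _ (by omega)⟩
  rw [h0] at hcS
  have h3 : ‖((d + 1 : ℕ) : ℂ) * (S : ℂ) - m‖ ≤ d * B := by
    rw [hcS, add_sub_cancel_right]
    refine (norm_sum_le_of_le _ (f := _) (n := fun _ => B) ?_).trans_eq (by simp)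
    intro j hj
    have hj' := Finset.mem_range.1 hj
    exact hbd (j + 1) (Finset.mem_range.2 (by omega)) (by omega)
  have h4 : |((d + 1 : ℕ) : ℝ) * S - m| ≤ d * B := by
    rw [← Real.norm_eq_abs, ← Complex.norm_real]
    push_cast at h3 ⊢
    exact h3
  have haR : (0 : ℝ) < a := by exact_mod_cast ha0
  have hdR : (0 : ℝ) < ((d + 1 : ℕ) : ℝ) := by positivity
  have h5 : S - ((p - 1 : ℕ) : ℝ) / (a * ((d + 1 : ℕ) : ℝ)) =
      (((d + 1 : ℕ) : ℝ) * S - m) / ((d + 1 : ℕ) : ℝ) := by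
    rw [hm, Nat.cast_mul]
    field_simp
  rw [h5, abs_div, abs_of_pos hdR, div_le_iff₀ hdR]
  refine h4.trans ?_
  push_cast
  nlinarith

lemma aux_gcd_lift (n x h : ℕ) (hn : 0 < n) (hg : x.gcd n = h.gcd n) :
    ∃ u : ℕ, u.Coprime n ∧ u * h ≡ x [MOD n] := by
  set e := h.gcd n with he
  have he0 : 0 < e := Nat.gcd_pos_of_pos_right _ hn
  obtain ⟨m, hm⟩ : e ∣ n := Nat.gcd_dvd_right _ _
  obtain ⟨h', hh'⟩ : e ∣ h := Nat.gcd_dvd_left _ _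
  obtain ⟨x', hx'⟩ : e ∣ x := hg ▸ Nat.gcd_dvd_left _ _
  have c1 : h'.Coprime m := by
    have : e * h'.gcd m = e * 1 := by rw [← Nat.gcd_mul_left, ← hm, ← hh', mul_one]
    exact Nat.eq_of_mul_eq_mul_left he0 this
  have c2 : x'.Coprime m := by
    have : e * x'.gcd m = e * 1 := by rw [← Nat.gcd_mul_left, ← hm, ← hx', mul_one, hg]
    exact Nat.eq_of_mul_eq_mul_left he0 this
  have : NeZero n := ⟨hn.ne'⟩
  obtain ⟨u, hu⟩ := ZMod.unitsMap_surjective (Dvd.intro_left e hm.symm : m ∣ n)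
    (ZMod.unitOfCoprime x' c2 * (ZMod.unitOfCoprime h' c1)⁻¹)
  refine ⟨(u : ZMod n).val, ZMod.val_coe_unit_coprime u, ?_⟩
  suffices hs : (u : ZMod n).val * h' ≡ x' [MOD m] by
    have h2 := Nat.ModEq.mul_left' e hs
    rwa [← hm, mul_left_comm, ← hh', ← hx'] at h2
  rw [← ZMod.natCast_eq_natCast_iff]
  have h1 := congrArg (fun v : (ZMod m)ˣ => (v : ZMod m)) (eq_mul_inv_iff_mul_eq.1 hu)
  simp only [Units.val_mul, ZMod.unitsMap_val, ZMod.coe_unitOfCoprime] at h1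
  rw [Nat.cast_mul, ← h1, ZMod.natCast_val]

lemma aux_iff (p : ℕ) [Fact p.Prime] (g0 : ZMod p) (hg0 : IsPrimitiveRoot g0 (p - 1))
    (x h : ℕ) (hx : g0 ^ x = (h : ZMod p)) :
    (∃ g : ℕ, 1 ≤ g ∧ g ≤ p - 1 ∧ IsPrimitiveRoot (g : ZMod p) (p - 1) ∧ g ^ h ≡ h [MOD p]) ↔
      h.gcd (p - 1) = x.gcd (p - 1) := by
  have hpp : p.Prime := Fact.out
  have hn : 0 < p - 1 := by have := hpp.two_le; omega
  have : NeZero (p - 1) := ⟨hn.ne'⟩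
  have hfin : IsOfFinOrder g0 := isOfFinOrder_iff_pow_eq_one.2 ⟨p - 1, hn, hg0.pow_eq_one⟩
  constructor
  · rintro ⟨g, -, -, hg, hgh⟩
    obtain ⟨u, -, hu, hgu⟩ := (hg0.isPrimitiveRoot_iff).1 hg
    rw [← ZMod.natCast_eq_natCast_iff] at hgh
    push_cast at hgh
    rw [← hgu, ← hx, ← pow_mul] at hgh
    have h2 : u * h ≡ x [MOD (p - 1)] := by
      have := hfin.pow_eq_pow_iff_modEq.1 hgh
      rwa [← hg0.eq_orderOf] at this
    have h3 := h2.gcd_eq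
    rw [← h3]
    exact (Nat.Coprime.gcd_mul_left_cancel h hu).symm
  · intro hgcd
    obtain ⟨u, hu, hux⟩ := aux_gcd_lift (p - 1) x h hn hgcd.symm
    have hpr := hg0.pow_of_coprime u hu
    have hne : g0 ^ u ≠ 0 := by
      intro h
      have := hpr.pow_eq_one
      rw [h, zero_pow hn.ne'] at this
      exact zero_ne_one this
    refine ⟨(g0 ^ u).val, ?_, ?_, ?_, ?_⟩
    · exact Nat.pos_of_ne_zero (fun h => hne ((ZMod.val_eq_zero _).1 h))
    · have := ZMod.val_lt (g0 ^ u)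
      omega
    · rw [ZMod.natCast_zmod_val]
      exact hpr
    · rw [← ZMod.natCast_eq_natCast_iff, Nat.cast_pow, ZMod.natCast_zmod_val, ← hx, ← pow_mul]
      rw [hfin.pow_eq_pow_iff_modEq, ← hg0.eq_orderOf]
      exact hux

lemma aux_exists (p : ℕ) [Fact p.Prime] : ∃ (g0 : ZMod p) (ind : ℕ → ℕ) (χ : MulChar (ZMod p) ℂ),
    IsPrimitiveRoot g0 (p - 1) ∧ (∀ h ∈ Finset.Icc 1 (p - 1), g0 ^ ind h = (h : ZMod p)) ∧
    IsPrimitiveRoot (χ g0) (p - 1) := by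
  have hpp : p.Prime := Fact.out
  have hn : 0 < p - 1 := by have := hpp.two_le; omega
  obtain ⟨g, hg⟩ := IsCyclic.exists_generator (α := (ZMod p)ˣ)
  have hord : orderOf g = p - 1 := by
    rw [orderOf_eq_card_of_forall_mem_zpowers hg, Nat.card_eq_fintype_card, ZMod.card_units]
  have hg0 : IsPrimitiveRoot ((g : ZMod p)) (p - 1) := by
    rw [← hord, ← orderOf_units]
    exact IsPrimitiveRoot.orderOf _
  have hex : ∀ h : ℕ, ∃ i : ℕ, h ∈ Finset.Icc 1 (p - 1) → (g : ZMod p) ^ i = (h : ZMod p) := by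
    intro h
    by_cases hh : h ∈ Finset.Icc 1 (p - 1)
    · rw [Finset.mem_Icc] at hh
      have hne : (h : ZMod p) ≠ 0 := by
        intro h0
        rw [ZMod.natCast_eq_zero_iff] at h0
        have := Nat.le_of_dvd (by omega) h0
        omega
      obtain ⟨i, hi⟩ := (mem_powers_iff_mem_zpowers).2 (hg (Units.mk0 _ hne))
      refine ⟨i, fun _ => ?_⟩
      have := congrArg (fun v : (ZMod p)ˣ => (v : ZMod p)) hi
      simpa using this
    · exact ⟨0, fun h' => absurd h' hh⟩
  choose ind hind using hex
  obtain ⟨χ, hχ⟩ := MulChar.exists_mulChar_orderOf (ZMod p) (n := p - 1) (by rw [ZMod.card])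
    (Complex.isPrimitiveRoot_exp (p - 1) hn.ne')
  refine ⟨g, ind, χ, hg0, hind, ?_, ?_⟩
  · rw [← map_pow, hg0.pow_eq_one, map_one]
  · intro l hl
    rw [← hχ]
    apply orderOf_dvd_of_pow_eq_one
    rw [MulChar.eq_iff hg, MulChar.pow_apply_coe, hl, MulChar.one_apply_coe]

/-- For a prime `p`, the number of `h` with `1 ≤ h ≤ p-1` for which there exists a primitive
root `g` mod `p` with `1 ≤ g ≤ p-1` and `g^h ≡ h (mod p)` differs from
`(1/(p-1)) Σ_{e ∣ p-1} φ((p-1)/e)²` by at most `d(p-1)³ √p (1 + ln p)`. -/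
theorem G_gPR_hANY (p : ℕ) (hp : p.Prime) :
    |(Nat.card {h : ℕ // 1 ≤ h ∧ h ≤ p - 1 ∧ ∃ g : ℕ, 1 ≤ g ∧ g ≤ p - 1 ∧
        IsPrimitiveRoot (g : ZMod p) (p - 1) ∧ g ^ h ≡ h [MOD p]} : ℝ) -
      (1 / ((p - 1 : ℕ) : ℝ)) * ∑ e ∈ (p - 1).divisors, (((p - 1) / e).totient : ℝ) ^ 2| ≤
    ((p - 1).divisors.card : ℝ) ^ 3 * Real.sqrt p * (1 + Real.log p) := by
  have : Fact p.Prime := ⟨hp⟩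
  obtain ⟨g0, ind, χ, hg0, hind, hχ⟩ := aux_exists p
  have hn : 0 < p - 1 := by have := hp.two_le; omega
  set n := p - 1 with hndef
  set B := Real.sqrt p * (1 + Real.log p) with hB
  have hB0 : 0 ≤ B := by
    have := Real.log_natCast_nonneg p
    positivity
  have hcard : (Nat.card {h : ℕ // 1 ≤ h ∧ h ≤ n ∧ ∃ g : ℕ, 1 ≤ g ∧ g ≤ n ∧
        IsPrimitiveRoot (g : ZMod p) n ∧ g ^ h ≡ h [MOD p]} : ℝ) =
      ∑ h ∈ Finset.Icc 1 n, if h.gcd n = (ind h).gcd n then (1 : ℝ) else 0 := by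
    rw [Finset.sum_boole, Nat.subtype_card]
    intro h
    rw [Finset.mem_filter, Finset.mem_Icc, and_assoc]
    constructor
    · rintro ⟨h1, h2, h3⟩
      exact ⟨h1, h2, (aux_iff p g0 hg0 _ h (hind h (Finset.mem_Icc.2 ⟨h1, h2⟩))).2 h3⟩
    · rintro ⟨h1, h2, h3⟩
      exact ⟨h1, h2, (aux_iff p g0 hg0 _ h (hind h (Finset.mem_Icc.2 ⟨h1, h2⟩))).1 h3⟩
  have hsplit : ∀ h : ℕ, (if h.gcd n = (ind h).gcd n then (1 : ℝ) else 0) =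
      ∑ e ∈ n.divisors, (if h.gcd n = e then (1 : ℝ) else 0) *
        (if (ind h).gcd n = e then 1 else 0) := by
    intro h
    simp only [ite_mul, one_mul, zero_mul]
    rw [Finset.sum_ite_eq, if_pos (Nat.mem_divisors.2 ⟨Nat.gcd_dvd_right _ _, hn.ne'⟩)]
    simp only [eq_comm]
  let N : ℕ → ℕ → ℝ := fun a c => ∑ h ∈ Finset.Icc 1 n, (if a ∣ h then (1 : ℝ) else 0) *
    (if c ∣ ind h then 1 else 0)
  let μ : ℕ → ℝ := fun b => (ArithmeticFunction.moebius b : ℝ)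
  have hμ : ∀ b, |μ b| ≤ 1 := by
    intro b
    have := ArithmeticFunction.abs_moebius_le_one (n := b)
    simp only [μ]
    exact_mod_cast this
  have hmain1 : (Nat.card {h : ℕ // 1 ≤ h ∧ h ≤ n ∧ ∃ g : ℕ, 1 ≤ g ∧ g ≤ n ∧
        IsPrimitiveRoot (g : ZMod p) n ∧ g ^ h ≡ h [MOD p]} : ℝ) =
      ∑ e ∈ n.divisors, ∑ b ∈ (n / e).divisors, ∑ c ∈ (n / e).divisors,
        μ b * μ c * N (e * b) (e * c) := by
    rw [hcard]
    simp_rw [hsplit]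
    rw [Finset.sum_comm]
    apply Finset.sum_congr rfl
    intro e he
    have he' := Nat.dvd_of_mem_divisors he
    have : ∀ h : ℕ, (if h.gcd n = e then (1 : ℝ) else 0) *
        (if (ind h).gcd n = e then 1 else 0) =
        ∑ b ∈ (n / e).divisors, ∑ c ∈ (n / e).divisors, μ b * μ c *
          ((if e * b ∣ h then (1 : ℝ) else 0) * (if e * c ∣ ind h then 1 else 0)) := by
      intro h
      rw [aux_moebius n e h hn he', aux_moebius n e (ind h) hn he', Finset.sum_mul_sum]
      refine Finset.sum_congr rfl fun b _ => Finset.sum_congr rfl fun c _ => ?_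
      simp only [μ]
      ring
    simp_rw [this]
    rw [Finset.sum_comm]
    refine Finset.sum_congr rfl fun b _ => ?_
    rw [Finset.sum_comm]
    refine Finset.sum_congr rfl fun c _ => ?_
    simp only [N, Finset.mul_sum]
  have hnR : (0 : ℝ) < (n : ℝ) := by exact_mod_cast hn
  have hmain2 : (1 / (n : ℝ)) * ∑ e ∈ n.divisors, ((n / e).totient : ℝ) ^ 2 =
      ∑ e ∈ n.divisors, ∑ b ∈ (n / e).divisors, ∑ c ∈ (n / e).divisors,
        μ b * μ c * ((n : ℝ) / (((e * b : ℕ) : ℝ) * ((e * c : ℕ) : ℝ))) := by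
    rw [Finset.mul_sum]
    apply Finset.sum_congr rfl
    intro e he
    have he' := Nat.dvd_of_mem_divisors he
    have he0 := Nat.pos_of_mem_divisors he
    have heR : (e : ℝ) ≠ 0 := by exact_mod_cast he0.ne'
    rw [aux_totient _ (Nat.div_pos (Nat.le_of_dvd hn he') he0), sq, Finset.sum_mul_sum,
      Finset.mul_sum]
    refine Finset.sum_congr rfl fun b hb => ?_
    rw [Finset.mul_sum]
    refine Finset.sum_congr rfl fun c hc => ?_
    have hbR : (b : ℝ) ≠ 0 := by exact_mod_cast (Nat.pos_of_mem_divisors hb).ne'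
    have hcR : (c : ℝ) ≠ 0 := by exact_mod_cast (Nat.pos_of_mem_divisors hc).ne'
    rw [Nat.cast_div he' heR]
    simp only [μ]
    push_cast
    field_simp
  rw [hmain1, hmain2, ← Finset.sum_sub_distrib]
  have hterm : ∀ e ∈ n.divisors, |∑ b ∈ (n / e).divisors, ∑ c ∈ (n / e).divisors,
        μ b * μ c * N (e * b) (e * c) - ∑ b ∈ (n / e).divisors, ∑ c ∈ (n / e).divisors,
        μ b * μ c * ((n : ℝ) / (((e * b : ℕ) : ℝ) * ((e * c : ℕ) : ℝ)))| ≤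
        (n.divisors.card : ℝ) ^ 2 * B := by
    intro e he
    have he' := Nat.dvd_of_mem_divisors he
    have hdvd : ∀ b ∈ (n / e).divisors, e * b ∣ n := by
      intro b hb
      have := Nat.mul_dvd_mul_left e (Nat.dvd_of_mem_divisors hb)
      rwa [Nat.mul_div_cancel' he'] at this
    have hle : ((n / e).divisors.card : ℝ) ≤ n.divisors.card := by
      exact_mod_cast Finset.card_le_card
        (Nat.divisors_subset_of_dvd hn.ne' (Nat.div_dvd_of_dvd he'))
    rw [← Finset.sum_sub_distrib]
    simp_rw [← Finset.sum_sub_distrib, ← mul_sub]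
    calc _ ≤ ∑ b ∈ (n / e).divisors, ∑ c ∈ (n / e).divisors, B := by
          refine (Finset.abs_sum_le_sum_abs _ _).trans (Finset.sum_le_sum fun b hb => ?_)
          refine (Finset.abs_sum_le_sum_abs _ _).trans (Finset.sum_le_sum fun c hc => ?_)
          have h1 := aux_N p g0 hg0 ind hind χ hχ (e * b) (e * c) (hdvd b hb) (hdvd c hc)
          rw [abs_mul, abs_mul]
          have h2 : |μ b| * |μ c| ≤ 1 :=
            mul_le_one₀ (hμ b) (abs_nonneg _) (hμ c)
          calc _ ≤ 1 * B := mul_le_mul h2 h1 (abs_nonneg _) zero_le_one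
            _ = B := one_mul _
      _ = ((n / e).divisors.card : ℝ) ^ 2 * B := by
          simp only [Finset.sum_const, nsmul_eq_mul]
          ring
      _ ≤ _ := by gcongr
  calc _ ≤ ∑ e ∈ n.divisors, (n.divisors.card : ℝ) ^ 2 * B :=
        (Finset.abs_sum_le_sum_abs _ _).trans (Finset.sum_le_sum hterm)
    _ = _ := by
        simp only [Finset.sum_const, nsmul_eq_mul, hB]
        ring
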